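/- arXiv:math/0009196 — 3 statements merged into one kernel-verified Lean document; each statement's English description precedes it below -/
import Mathlib

section
/- Let n ≥ 1 and 1 ≤ r ≤ n, and let p = x₁⋯x_r be the product of the first r variables in ℂ[[x₁,…,xₙ]]. If a₁,…,a_r ∈ ℂ[[x₁,…,xₙ]] satisfy that p divides aᵢ·xᵢ for every i = 1,…,r, and p divides a₁ + ⋯ + a_r, then p divides aᵢ for every i = 1,…,r. (This is the content of Lemma 1.2: in the local ring O = ℂ[[x₁,…,xₙ]]/(x₁⋯x_r) of a normal crossing singularity, any O-linear functional on the logarithmic differential module Ω¹(log) that vanishes on all exact logarithmic differentials d̄f is zero, i.e. the natural surjection Ω¹(log)* → T(log), u ↦ u∘d̄, is injective.) -/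
open MvPowerSeries in
theorem MvPowerSeries.X_dvd_of_dvd_X_mul {σ R : Type*} [CommSemiring R] {i j : σ} (hij : i ≠ j)
    {c : MvPowerSeries σ R} (h : X i ∣ X j * c) : (X i : MvPowerSeries σ R) ∣ c := by
  rw [X_dvd_iff] at h ⊢
  intro m hm
  have hcoeff := h (Finsupp.single j 1 + m) (by simp [hm, hij])
  rwa [X_def, coeff_add_monomial_mul, one_mul] at hcoeff

open MvPowerSeries in
theorem MvPowerSeries.X_dvd_of_dvd_prod_X_mul {σ R : Type*} [CommSemiring R] {i : σ}
    {s : Finset σ} (hi : i ∉ s) {c : MvPowerSeries σ R} (h : X i ∣ (∏ j ∈ s, X j) * c) :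
    (X i : MvPowerSeries σ R) ∣ c := by
  classical
  induction s using Finset.induction_on with
  | empty => simpa using h
  | insert j s hj ih =>
    rw [Finset.mem_insert, not_or] at hi
    rw [Finset.prod_insert hj, mul_assoc] at h
    exact ih hi.2 (X_dvd_of_dvd_X_mul hi.1 h)

open MvPowerSeries in
/-- If `∏ j ∈ s, X j` divides every `a i * X i` and the sum of the `a i`, it divides every `a i`. -/
theorem MvPowerSeries.prod_X_dvd_of_dvd_mul_X_of_dvd_sum {σ R : Type*} [CommRing R] [IsDomain R]
    (s : Finset σ) (a : σ → MvPowerSeries σ R)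
    (hdvd : ∀ i ∈ s, ∏ j ∈ s, X j ∣ a i * X i) (hsum : ∏ j ∈ s, X j ∣ ∑ i ∈ s, a i) :
    ∀ i ∈ s, ∏ j ∈ s, X j ∣ a i := by
  classical
  have hcancel : ∀ i ∈ s, ∏ j ∈ s.erase i, X j ∣ a i := fun i hi => by
    have h := hdvd i hi
    rw [← Finset.mul_prod_erase s _ hi, mul_comm (a i)] at h
    have hX : (X i : MvPowerSeries σ R) ≠ 0 := fun h0 => by
      simpa [coeff_X] using congrArg (coeff (Finsupp.single i 1)) h0
    exact (mul_dvd_mul_iff_left hX).1 h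
  intro i hi
  have hothers : X i ∣ ∑ j ∈ s.erase i, a j := Finset.dvd_sum fun j hj =>
    (Finset.dvd_prod_of_mem (fun k => (X k : MvPowerSeries σ R))
      (Finset.mem_erase.2 ⟨(Finset.ne_of_mem_erase hj).symm, hi⟩)).trans
      (hcancel j (Finset.mem_of_mem_erase hj))
  have hXi : X i ∣ a i := by
    refine (dvd_add_left hothers).1 ?_
    rw [Finset.add_sum_erase s a hi]
    exact (Finset.dvd_prod_of_mem _ hi).trans hsum
  obtain ⟨c, hc⟩ := hcancel i hi
  rw [hc] at hXi ⊢
  rw [← Finset.prod_erase_mul s _ hi]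
  exact mul_dvd_mul_left _ (X_dvd_of_dvd_prod_X_mul (Finset.notMem_erase i s) hXi)

/-- In `ℂ[[x₁,…,xₙ]]` with `p = x₁⋯x_r` (`1 ≤ r ≤ n`), if `p ∣ aᵢ·xᵢ`
for every `i < r` and `p` divides the sum of the `aᵢ`, then `p ∣ aᵢ` for every `i < r`. -/
theorem log_derivation_injectivity (n r : ℕ) (hn : 1 ≤ n) (hr1 : 1 ≤ r) (hrn : r ≤ n)
    (p : MvPowerSeries (Fin n) ℂ)
    (hp : p = ∏ i ∈ Finset.univ.filter (fun i : Fin n => (i : ℕ) < r), MvPowerSeries.X i)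
    (a : Fin n → MvPowerSeries (Fin n) ℂ)
    (hdvd : ∀ i : Fin n, (i : ℕ) < r → p ∣ a i * MvPowerSeries.X i)
    (hsum : p ∣ ∑ i ∈ Finset.univ.filter (fun i : Fin n => (i : ℕ) < r), a i) :
    ∀ i : Fin n, (i : ℕ) < r → p ∣ a i := by
  subst hp
  intro i hi
  exact MvPowerSeries.prod_X_dvd_of_dvd_mul_X_of_dvd_sum _ a
    (fun j hj => hdvd j (Finset.mem_filter.1 hj).2) hsum i (by simpa using hi)
end

section
/- Let A be an associative unital ring and let D₁,…,D_r, x₁,…,x_r ∈ A be such that: the Dᵢ pairwise commute, the xᵢ pairwise commute, Dᵢxᵢ − xᵢDᵢ = xᵢ for every i, and Dᵢxⱼ = xⱼDᵢ whenever i ≠ j. Then for all exponents β₁,…,β_r ≥ 0, the iterated commutator taken first β₁ times with x₁, then β₂ times with x₂, …, then β_r times with x_r satisfies [D₁^{β₁}⋯D_r^{β_r}, x₁^{⋆β₁}⋆x₂^{⋆β₂}⋆⋯⋆x_r^{⋆β_r}] = (β₁!)(β₂!)⋯(β_r!)·x₁^{β₁}x₂^{β₂}⋯x_r^{β_r}.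 (This is the product formula [∂₁^{β₁}⋯∂_r^{β_r}, f₁^{⋆β₁}⋆⋯⋆f_r^{⋆β_r}] = (β₁!)⋯(β_r!)f₁^{β₁}⋯f_r^{β_r} used in Section 1 to prove formula (1.2) and the uniqueness statement in Proposition 1.4.) -/
/-- The iterated commutator of `a` with a list `l = [b₁, b₂, …]` of ring elements:
`[a, l] = [[⋯[a, b₁], b₂⋯], bₘ]` where `[c, b] = c*b - b*c`. -/
def iterCommList {A : Type*} [Ring A] (a : A) (l : List A) : A :=
  l.foldl (fun c b => c * b - b * c) a

theorem fwdDiff_iter_add_pow {A : Type*} [Ring A] (D : A) (n : ℕ) :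
    (fwdDiff 1)^[n] (fun k : ℕ => (D + k) ^ n) 0 = (n.factorial : A) := by
  have h := congrFun (fwdDiff_iter_eq_factorial (R := Polynomial ℤ) (n := n)) Polynomial.X
  rw [fwdDiff_iter_eq_sum_shift] at h
  rw [fwdDiff_iter_eq_sum_shift]
  simpa using congrArg (Polynomial.aeval D) h

theorem iterCommList_append {A : Type*} [Ring A] (a : A) (l l' : List A) :
    iterCommList a (l ++ l') = iterCommList (iterCommList a l) l' :=
  List.foldl_append

theorem iterCommList_replicate_succ {A : Type*} [Ring A] (a x : A) (n : ℕ) :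
    iterCommList a (List.replicate (n + 1) x) =
      iterCommList (a * x - x * a) (List.replicate n x) :=
  rfl

/-- Left and right factors commuting with `x` pass through iterated commutators with `x`. -/
theorem iterCommList_replicate_mul_mul {A : Type*} [Ring A] {c p x : A} (hc : Commute c x)
    (hp : Commute p x) (n : ℕ) (a : A) :
    iterCommList (c * a * p) (List.replicate n x) =
      c * iterCommList a (List.replicate n x) * p := by
  induction n generalizing a with
  | zero => rfl
  | succ n ih =>
    rw [iterCommList_replicate_succ, iterCommList_replicate_succ, ← ih]
    congr 1
    rw [mul_assoc _ p, hp.eq, ← mul_assoc x, ← mul_assoc x, ← hc.eq]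
    noncomm_ring

/-- If moving `x` to the left shifts the argument of `f`, then iterated commutators with `x`
are iterated forward differences of `f`. -/
theorem iterCommList_replicate_eq_pow_mul_fwdDiff {A : Type*} [Ring A] (x : A) (n : ℕ)
    (f : ℕ → A) (hf : ∀ k, f k * x = x * f (k + 1)) :
    iterCommList (f 0) (List.replicate n x) = x ^ n * (fwdDiff 1)^[n] f 0 := by
  induction n generalizing f with
  | zero => simp [iterCommList]
  | succ n ih =>
    have hstep : f 0 * x - x * f 0 = x * fwdDiff 1 f 0 * 1 := by
      rw [hf, fwdDiff, mul_one, mul_sub]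
    rw [iterCommList_replicate_succ, hstep,
      iterCommList_replicate_mul_mul (Commute.refl x) (Commute.one_left x), ih (fwdDiff 1 f) ?_,
      Function.iterate_succ_apply, pow_succ', mul_one, mul_assoc]
    intro k
    simp only [fwdDiff, sub_mul, mul_sub, hf]

theorem iterCommList_pow_replicate {A : Type*} [Ring A] {D x : A} (h : D * x - x * D = x)
    (n : ℕ) :
    iterCommList (D ^ n) (List.replicate n x) = (n.factorial : A) * x ^ n := by
  have hshift (k : ℕ) : SemiconjBy x (D + (k + 1 : ℕ)) (D + k) := by
    rw [SemiconjBy, mul_add, add_mul, sub_eq_iff_eq_add.mp h, (Nat.cast_commute k x).eq]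
    push_cast
    noncomm_ring
  have := iterCommList_replicate_eq_pow_mul_fwdDiff x n (fun k : ℕ => (D + k) ^ n)
    fun k => ((hshift k).pow_right n).eq.symm
  rw [fwdDiff_iter_add_pow, ← (Nat.cast_commute _ _).eq] at this
  simpa using this

theorem iterCommList_mul_prod_map_pow {ι A : Type*} [Ring A] {D x : ι → A}
    (hxx : ∀ i j, x i * x j = x j * x i)
    (hDx : ∀ i, D i * x i - x i * D i = x i)
    (hDxne : ∀ i j, i ≠ j → D i * x j = x j * D i)
    (β : ι → ℕ) {l : List ι} (hl : l.Nodup) (c : A) (hc : ∀ i ∈ l, Commute c (x i)) :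
    iterCommList (c * (l.map fun i => D i ^ β i).prod)
        (l.map fun i => List.replicate (β i) (x i)).flatten =
      (((l.map fun i => (β i).factorial).prod : ℕ) : A) * (c * (l.map fun i => x i ^ β i).prod) := by
  induction l generalizing c with
  | nil => simp [iterCommList]
  | cons i l ih =>
    obtain ⟨hi, hl⟩ := List.nodup_cons.mp hl
    have hp : Commute (l.map fun j => D j ^ β j).prod (x i) := by
      refine Commute.list_prod_left _ _ fun y hy => ?_
      obtain ⟨j, hj, rfl⟩ := List.mem_map.mp hy
      exact Commute.pow_left (hDxne j i fun h => hi (h ▸ hj)) _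
    simp only [List.map_cons, List.prod_cons, List.flatten_cons]
    rw [iterCommList_append, ← mul_assoc,
      iterCommList_replicate_mul_mul (hc i List.mem_cons_self) hp,
      iterCommList_pow_replicate (hDx i), ih hl]
    · rw [mul_comm (β i).factorial, Nat.cast_mul, mul_assoc (Nat.cast _) (Nat.cast _),
        ← mul_assoc c, ← (Nat.cast_commute (β i).factorial c).eq]
      simp only [mul_assoc]
    · intro j hj
      exact (hc j (List.mem_cons_of_mem _ hj)).mul_left
        ((Nat.cast_commute _ _).mul_left (Commute.pow_left (hxx i j) _))

/-- For `D₁,…,D_r` pairwise commuting, `x₁,…,x_r` pairwise commuting,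
with `Dᵢxᵢ - xᵢDᵢ = xᵢ` and `Dᵢxⱼ = xⱼDᵢ` for `i ≠ j`, one has
`[D₁^{β₁}⋯D_r^{β_r}, x₁^{⋆β₁}⋆x₂^{⋆β₂}⋆⋯⋆x_r^{⋆β_r}]
  = (β₁!)(β₂!)⋯(β_r!) · x₁^{β₁}x₂^{β₂}⋯x_r^{β_r}`. -/
theorem iterComm_prod_eq_factorials_mul_prod {A : Type*} [Ring A] (r : ℕ) (D x : Fin r → A)
    (hDD : ∀ i j, D i * D j = D j * D i)
    (hxx : ∀ i j, x i * x j = x j * x i)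
    (hDx : ∀ i, D i * x i - x i * D i = x i)
    (hDxne : ∀ i j, i ≠ j → D i * x j = x j * D i)
    (β : Fin r → ℕ) :
    iterCommList (((List.finRange r).map (fun j => D j ^ β j)).prod)
        (((List.finRange r).map (fun i => List.replicate (β i) (x i))).flatten) =
      ((∏ i : Fin r, Nat.factorial (β i) : ℕ) : A) *
        (((List.finRange r).map (fun i => x i ^ β i)).prod) := by
  have h := iterCommList_mul_prod_map_pow hxx hDx hDxne β (List.nodup_finRange r) 1
    fun i _ => Commute.one_left (x i)
  rw [one_mul, one_mul] at h
  rw [h, ← List.ofFn_eq_map (f := fun i => (β i).factorial), List.prod_ofFn]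
end

section
/- Fix k, δ, c ∈ ℂ with c ≠ 0, and let D : ℂ[u] → ℂ[u] be the operator D(s) = δ·s + k·u·(ds/du). If there exists a nonzero polynomial s of degree ≤ 1 such that coeff₁(s) = c·coeff₀(s) and coeff₁(D(s)) = c·coeff₀(D(s)), then k = 0. (This is Lemma 3.3: for the line bundle L = O(1) on ℙ¹ with the logarithmic structure given by the two points p₁ = (1,0) and p₂ = (0,1), if a global first-order logarithmic differential operator D on L admits a nonzero section s ∈ H⁰(L) and c ∈ ℂ* with s(p₂) = c·s(p₁) and D(s)(p₂) = c·D(s)(p₁), then the symbol of D is trivial.) -/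
/-- Lemma 3.3: Let `D(s) = δ·s + k·u·(ds/du)` on `ℂ[u]` and `c ≠ 0`.
If there is a nonzero polynomial `s` of degree ≤ 1 with `coeff₁(s) = c·coeff₀(s)` and
`coeff₁(D(s)) = c·coeff₀(D(s))`, then `k = 0` (the symbol of `D` is trivial). -/
theorem symbol_trivial_of_section (k δ c : ℂ) (hc : c ≠ 0)
    (D : Polynomial ℂ → Polynomial ℂ)
    (hD : ∀ s, D s = Polynomial.C δ * s + Polynomial.C k * (Polynomial.X * Polynomial.derivative s))
    (h : ∃ s : Polynomial ℂ, s ≠ 0 ∧ s.degree ≤ 1 ∧ s.coeff 1 = c * s.coeff 0 ∧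
      (D s).coeff 1 = c * (D s).coeff 0) :
    k = 0 := by
  obtain ⟨s, hs, hdeg, h₁, h₂⟩ := h
  have h₀ : s.coeff 0 ≠ 0 := by
    intro h₀
    apply hs
    rw [Polynomial.eq_X_add_C_of_degree_le_one hdeg, h₁, h₀]
    simp
  have hcoeff : k * s.coeff 1 = 0 := by
    simp [hD, Polynomial.coeff_X_mul, Polynomial.coeff_derivative] at h₂
    linear_combination h₂ - δ * h₁
  rw [h₁] at hcoeff
  exact (mul_eq_zero.mp hcoeff).resolve_right (mul_ne_zero hc h₀)
end
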